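/- If r ∈ {3,…,n-1}, then n · |Π_n(r)| = |Λ_n(r)|; that is, |Π_n(r)| / |Λ_n(r)| = 1/n. -/

import Mathlib

open Finset

namespace Secretary

/-- Relative rank of `x` with regard to `P`: the number of `z ∈ P` with `z ≤ x`
(as an integer, so that differences can be computed in `ℤ`). -/
def rr {n : ℕ} (P : Finset (Fin n)) (x : Fin n) : ℤ :=
  ((P.filter fun z => z ≤ x).card : ℤ)

/-- `Δ(k) = {-1, 1, k-1, 1-k} ⊆ ℤ`. -/
def Δ (k : ℕ) : Finset ℤ := {-1, 1, (k : ℤ) - 1, 1 - (k : ℤ)}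

/-- `{x, y} ∈ Adj(P)`: both belong to `P` and the difference of their relative
ranks with regard to `P` (in one of the two orders) lies in `Δ(|P|)`. -/
def Adj {n : ℕ} (P : Finset (Fin n)) (x y : Fin n) : Prop :=
  x ∈ P ∧ y ∈ P ∧ (rr P x - rr P y ∈ Δ P.card ∨ rr P y - rr P x ∈ Δ P.card)

instance {n : ℕ} (P : Finset (Fin n)) (x y : Fin n) : Decidable (Adj P x y) := by
  unfold Adj; infer_instance

/-- `Ω n`: the sequences of `n` distinct applicants (as injective, hence
bijective, functions `Fin n → Fin n`); `|Ω n| = n!`. -/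
def Ω (n : ℕ) : Finset (Fin n → Fin n) :=
  Finset.univ.filter Function.Injective

/-- The `i`-th applicant of the sequence `x`, with the 1-based indexing
`x_1, …, x_n` of the paper. -/
def get {n : ℕ} [NeZero n] (x : Fin n → Fin n) (i : ℕ) : Fin n :=
  x ⟨(i - 1) % n, Nat.mod_lt _ (Nat.pos_of_ne_zero (NeZero.ne n))⟩

/-- The set `{x_1, …, x_i}` of the first `i` applicants of the sequence `x`. -/
def pre {n : ℕ} (x : Fin n → Fin n) (i : ℕ) : Finset (Fin n) :=
  (Finset.univ.filter fun j : Fin n => (j : ℕ) < i).image x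

/-- `Λ_n(r,k)`: sequences `x ∈ Ω_n` with `{x_k, x_{k+1}} ∈ Adj(C_n)` and
`{x_{i-1}, x_i} ∉ Adj({x_1,…,x_i})` for all `i ∈ {r,…,k}`. -/
def Lam : (n : ℕ) → ℕ → ℕ → Finset (Fin n → Fin n)
  | 0, _, _ => ∅
  | (m + 1), r, k =>
      (Ω (m + 1)).filter fun x =>
        Adj Finset.univ (get x k) (get x (k + 1)) ∧
          ∀ i, i ≤ k → r ≤ i → ¬ Adj (pre x i) (get x (i - 1)) (get x i)

/-- `Λ_n(r) = ⋃_{k=r}^{n-1} Λ_n(r,k)`. -/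
def LamU (n : ℕ) (r : ℕ) : Finset (Fin n → Fin n) :=
  (Finset.Icc r (n - 1)).biUnion fun k => Lam n r k

/-- `Π_n(r)`: those `x ∈ Λ_n(r)` such that for the (unique) `k` with
`x ∈ Λ_n(r,k)` one has `rr_n(x_k) - rr_n(x_{k+1}) ∈ {1-n, n-1}`. -/
def Pi' : (n : ℕ) → ℕ → Finset (Fin n → Fin n)
  | 0, _ => ∅
  | (m + 1), r =>
      (LamU (m + 1) r).filter fun x =>
        ∃ k ∈ Finset.Icc r m, x ∈ Lam (m + 1) r k ∧
          rr Finset.univ (get x k) - rr Finset.univ (get x (k + 1)) ∈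
            ({1 - ((m : ℤ) + 1), ((m : ℤ) + 1) - 1} : Finset ℤ)

/-- `Λ_n(r,k,z,z̄)`: sequences of `Λ_n(r,k)` with `x_k = z` and `x_{k+1} = z̄`. -/
def Lam4 : (n : ℕ) → ℕ → ℕ → Fin n → Fin n → Finset (Fin n → Fin n)
  | 0, _, _, z, _ => z.elim0
  | (m + 1), r, k, z, w =>
      (Lam (m + 1) r k).filter fun x => get x k = z ∧ get x (k + 1) = w

theorem Adj.symm {n : ℕ} {P : Finset (Fin n)} {x y : Fin n} (h : Adj P x y) : Adj P y x :=
  ⟨h.2.1, h.1, h.2.2.symm⟩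

theorem mem_Δ {k : ℕ} {d : ℤ} : d ∈ Δ k ↔ d = -1 ∨ d = 1 ∨ d = k - 1 ∨ d = 1 - k := by
  simp [Δ]

theorem rr_univ {n : ℕ} (x : Fin n) : rr univ x = x + 1 := by
  have h : (univ.filter fun z => z ≤ x) = Iic x := by ext; simp
  simp [rr, h]

theorem rr_last {m : ℕ} (P : Finset (Fin (m + 1))) : rr P (Fin.last m) = P.card := by
  simp [rr, Fin.le_last]

theorem rr_zero {m : ℕ} {P : Finset (Fin (m + 1))} (h : 0 ∈ P) : rr P 0 = 1 := by
  simp [rr, filter_eq', h]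

theorem one_le_rr {n : ℕ} {P : Finset (Fin n)} {x : Fin n} (h : x ∈ P) : 1 ≤ rr P x := by
  have : 0 < (P.filter fun z => z ≤ x).card := card_pos.2 ⟨x, by simp [h]⟩
  unfold rr
  omega

theorem rr_lt_card {n : ℕ} {P : Finset (Fin n)} {x y : Fin n} (hy : y ∈ P) (hxy : x < y) :
    rr P x < P.card := by
  unfold rr
  have h : (P.filter fun z => z ≤ x) ⊂ P := filter_ssubset.2 ⟨y, hy, not_le.2 hxy⟩
  exact_mod_cast card_lt_card h

theorem val_add_one_of_ne_last {m : ℕ} {x : Fin (m + 1)} (hx : x ≠ Fin.last m) :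
    ((x + 1 : Fin (m + 1)) : ℕ) = x + 1 := by
  rw [Fin.val_add_one, if_neg hx]

theorem rr_add_one_of_mem {m : ℕ} {P : Finset (Fin (m + 1))} {x : Fin (m + 1)}
    (hx : x ≠ Fin.last m) (h : x + 1 ∈ P) : rr P (x + 1) = rr P x + 1 := by
  have hv := val_add_one_of_ne_last hx
  have hs : (P.filter fun z => z ≤ x + 1) = insert (x + 1) (P.filter fun z => z ≤ x) := by
    ext z
    simp only [mem_filter, mem_insert, Fin.le_def, Fin.ext_iff, hv]
    constructor
    · rintro ⟨hz, hzx⟩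
      by_cases hz' : (z : ℕ) = x + 1
      · exact Or.inl hz'
      · exact Or.inr ⟨hz, by omega⟩
    · rintro (hz | ⟨hz, hzx⟩)
      · have : z = x + 1 := Fin.ext (by omega)
        exact ⟨this ▸ h, by omega⟩
      · exact ⟨hz, by omega⟩
  have hn : x + 1 ∉ P.filter fun z => z ≤ x := by
    simp only [mem_filter, Fin.le_def, hv]
    omega
  simp [rr, hs, card_insert_of_notMem hn]

theorem adj_univ_iff {m : ℕ} (hm : 1 ≤ m) {x y : Fin (m + 1)} :
    Adj univ x y ↔ y = x + 1 ∨ x = y + 1 := by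
  simp only [Adj, mem_univ, true_and, mem_Δ, rr_univ, card_univ, Fintype.card_fin, Fin.ext_iff,
    Fin.val_add_one, Fin.val_last]
  have := x.isLt
  have := y.isLt
  split_ifs <;> push_cast <;> omega

theorem adj_add_one {m : ℕ} {P : Finset (Fin (m + 1))} {x : Fin (m + 1)} (hx : x ∈ P)
    (hy : x + 1 ∈ P) : Adj P x (x + 1) := by
  refine ⟨hx, hy, Or.inl (mem_Δ.2 ?_)⟩
  by_cases h : x = Fin.last m
  · subst h
    rw [Fin.last_add_one] at hy ⊢
    rw [rr_last, rr_zero hy]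
    omega
  · rw [rr_add_one_of_mem h hy]
    omega

/-- Cyclic neighbours remain neighbours with regard to every smaller set containing them. -/
theorem Adj.of_univ {m : ℕ} (hm : 1 ≤ m) {P : Finset (Fin (m + 1))} {x y : Fin (m + 1)}
    (h : Adj univ x y) (hx : x ∈ P) (hy : y ∈ P) : Adj P x y := by
  rcases (adj_univ_iff hm).1 h with rfl | rfl
  · exact adj_add_one hx hy
  · exact (adj_add_one hy hx).symm

theorem rr_image_add_one {m : ℕ} (P : Finset (Fin (m + 1))) {x : Fin (m + 1)}
    (hx : x ≠ Fin.last m) :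
    rr (P.image (· + 1)) (x + 1) = rr P x + if Fin.last m ∈ P then 1 else 0 := by
  have hv := val_add_one_of_ne_last hx
  have hx' : (x : ℕ) ≠ m := fun h => hx (Fin.ext h)
  have h1 : rr (P.image (· + 1)) (x + 1) = (P.filter fun z => z + 1 ≤ x + 1).card := by
    rw [rr, filter_image, card_image_of_injective _ (add_left_injective 1)]
  have h2 : (P.filter fun z => z + 1 ≤ x + 1) =
      (P.filter fun z => z ≤ x) ∪ P.filter fun z => z = Fin.last m := by
    ext z
    simp only [mem_filter, mem_union, Fin.le_def, hv, Fin.val_add_one, ← and_or_left]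
    refine and_congr_right fun _ => ?_
    split_ifs with hz <;> simp [hz]
  have h3 : Disjoint (P.filter fun z => z ≤ x) (P.filter fun z => z = Fin.last m) := by
    refine disjoint_filter.2 ?_
    rintro z - hz rfl
    exact hx (Fin.last_le_iff.1 hz)
  rw [h1, h2, card_union_of_disjoint h3, rr, filter_eq']
  split_ifs <;> simp

theorem adj_image_add_one_of_ne_last {m : ℕ} {P : Finset (Fin (m + 1))} {x y : Fin (m + 1)}
    (h : Adj P x y) (hy : y ≠ Fin.last m) : Adj (P.image (· + 1)) (x + 1) (y + 1) := by
  obtain ⟨hxP, hyP, h⟩ := h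
  refine ⟨mem_image_of_mem _ hxP, mem_image_of_mem _ hyP, ?_⟩
  rw [card_image_of_injective _ (add_left_injective 1), rr_image_add_one P hy]
  by_cases hx : x = Fin.last m
  · subst hx
    have h0 : (0 : Fin (m + 1)) ∈ P.image (· + 1) :=
      mem_image.2 ⟨Fin.last m, hxP, Fin.last_add_one m⟩
    rw [Fin.last_add_one, rr_zero h0, if_pos hxP]
    rw [rr_last] at h
    have h1 := one_le_rr hyP
    have h2 := rr_lt_card hxP (Fin.lt_last_iff_ne_last.2 hy)
    simp only [mem_Δ] at h ⊢
    omega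
  · rw [rr_image_add_one P hx]
    simpa using h

theorem Adj.image_add_one {m : ℕ} {P : Finset (Fin (m + 1))} {x y : Fin (m + 1)}
    (h : Adj P x y) : Adj (P.image (· + 1)) (x + 1) (y + 1) := by
  by_cases hy : y = Fin.last m
  · by_cases hx : x = Fin.last m
    · subst hx hy
      obtain ⟨hP, -, h⟩ := h
      refine ⟨mem_image_of_mem _ hP, mem_image_of_mem _ hP, ?_⟩
      rw [card_image_of_injective _ (add_left_injective 1)]
      simpa using h
    · exact (adj_image_add_one_of_ne_last h.symm hx).symm
  · exact adj_image_add_one_of_ne_last h hy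

theorem Adj.image_add {m : ℕ} {P : Finset (Fin (m + 1))} {x y : Fin (m + 1)}
    (h : Adj P x y) (c : Fin (m + 1)) : Adj (P.image (· + c)) (x + c) (y + c) := by
  induction c using Fin.induction with
  | zero => simpa using h
  | succ j ih =>
    rw [← Fin.coeSucc_eq_succ]
    have := ih.image_add_one
    simpa only [image_image, Function.comp_def, add_assoc] using this

theorem adj_image_add_iff {m : ℕ} {P : Finset (Fin (m + 1))} {x y : Fin (m + 1)}
    (c : Fin (m + 1)) : Adj (P.image (· + c)) (x + c) (y + c) ↔ Adj P x y := by
  refine ⟨fun h => ?_, fun h => h.image_add c⟩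
  simpa only [image_image, Function.comp_def, add_neg_cancel_right, image_id'] using
    h.image_add (-c)

/-- The cyclic shift by `c` of all applicants in a sequence. -/
def shift {m : ℕ} (c : Fin (m + 1)) (x : Fin (m + 1) → Fin (m + 1)) : Fin (m + 1) → Fin (m + 1) :=
  fun i => x i + c

theorem get_shift {m : ℕ} (c : Fin (m + 1)) (x : Fin (m + 1) → Fin (m + 1)) (i : ℕ) :
    get (shift c x) i = get x i + c := rfl

theorem pre_shift {m : ℕ} (c : Fin (m + 1)) (x : Fin (m + 1) → Fin (m + 1)) (i : ℕ) :
    pre (shift c x) i = (pre x i).image (· + c) := by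
  rw [pre, pre, image_image]
  rfl

theorem mem_Lam {m r k : ℕ} {x : Fin (m + 1) → Fin (m + 1)} :
    x ∈ Lam (m + 1) r k ↔ Function.Injective x ∧ Adj univ (get x k) (get x (k + 1)) ∧
      ∀ i, i ≤ k → r ≤ i → ¬ Adj (pre x i) (get x (i - 1)) (get x i) := by
  simp [Lam, Ω]

theorem shift_mem_Lam {m r k : ℕ} {c : Fin (m + 1)} {x : Fin (m + 1) → Fin (m + 1)} :
    shift c x ∈ Lam (m + 1) r k ↔ x ∈ Lam (m + 1) r k := by
  have hu : (univ : Finset (Fin (m + 1))) = univ.image (· + c) :=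
    (image_univ_of_surjective (add_right_surjective c)).symm
  have hi : Function.Injective (shift c x) ↔ Function.Injective x :=
    (add_left_injective c).of_comp_iff x
  have ha : Adj univ (get x k + c) (get x (k + 1) + c) ↔ Adj univ (get x k) (get x (k + 1)) := by
    conv_lhs => rw [hu]
    exact adj_image_add_iff c
  simp only [mem_Lam, get_shift, pre_shift, adj_image_add_iff, hi, ha]

theorem get_mem_pre {m i j : ℕ} (x : Fin (m + 1) → Fin (m + 1)) (hi : 1 ≤ i) (hij : i ≤ j) :
    get x i ∈ pre x j := by
  refine mem_image_of_mem _ (mem_filter.2 ⟨mem_univ _, ?_⟩)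
  have := Nat.mod_le (i - 1) (m + 1)
  simp only
  omega

theorem not_mem_Lam_of_lt {m r k l : ℕ} (hm : 1 ≤ m) (hk : 1 ≤ k) (hrk : r ≤ k) (hkl : k < l)
    {x : Fin (m + 1) → Fin (m + 1)} (h : x ∈ Lam (m + 1) r k) : x ∉ Lam (m + 1) r l := by
  intro h'
  refine (mem_Lam.1 h').2.2 (k + 1) hkl (by omega) ?_
  exact (mem_Lam.1 h).2.1.of_univ hm (get_mem_pre x hk (by omega))
    (get_mem_pre x (by omega) le_rfl)

theorem eq_of_mem_Lam {m r k l : ℕ} (hm : 1 ≤ m) (hr : 1 ≤ r) (hk : r ≤ k) (hl : r ≤ l)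
    {x : Fin (m + 1) → Fin (m + 1)} (h : x ∈ Lam (m + 1) r k) (h' : x ∈ Lam (m + 1) r l) :
    k = l := by
  rcases lt_trichotomy k l with hkl | hkl | hkl
  · exact absurd h' (not_mem_Lam_of_lt hm (hr.trans hk) hk hkl h)
  · exact hkl
  · exact absurd h (not_mem_Lam_of_lt hm (hr.trans hl) hl hkl h')

theorem mem_LamU {m r : ℕ} {x : Fin (m + 1) → Fin (m + 1)} :
    x ∈ LamU (m + 1) r ↔ ∃ k, (r ≤ k ∧ k ≤ m) ∧ x ∈ Lam (m + 1) r k := by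
  simp [LamU]

theorem rr_univ_sub_mem_iff {m : ℕ} {x y : Fin (m + 1)} :
    rr univ x - rr univ y ∈ ({1 - ((m : ℤ) + 1), ((m : ℤ) + 1) - 1} : Finset ℤ) ↔
      (x = 0 ∧ y = Fin.last m) ∨ (x = Fin.last m ∧ y = 0) := by
  simp only [mem_insert, mem_singleton, rr_univ, Fin.ext_iff, Fin.val_zero, Fin.val_last]
  omega

theorem mem_Pi' {m r : ℕ} {x : Fin (m + 1) → Fin (m + 1)} :
    x ∈ Pi' (m + 1) r ↔ ∃ k, (r ≤ k ∧ k ≤ m) ∧ x ∈ Lam (m + 1) r k ∧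
      ((get x k = 0 ∧ get x (k + 1) = Fin.last m) ∨
        (get x k = Fin.last m ∧ get x (k + 1) = 0)) := by
  simp only [Pi', mem_filter, rr_univ_sub_mem_iff, mem_Icc, mem_LamU]
  exact ⟨fun h => h.2, fun ⟨k, hk, h⟩ => ⟨⟨k, hk, h.1⟩, k, hk, h⟩⟩

theorem last_ne_neg_last {m : ℕ} (hm : 2 ≤ m) : -Fin.last m ≠ Fin.last m := by
  have h1 : (1 : Fin (m + 1)) = -Fin.last m :=
    eq_neg_of_add_eq_zero_right (Fin.last_add_one m)
  rw [← h1]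
  intro h
  have := congrArg Fin.val h
  rw [Fin.val_one', Fin.val_last, Nat.mod_eq_of_lt (by omega)] at this
  omega

/-- A cyclic shift preserving the pair `{0, n - 1}` of extreme applicants is trivial. -/
theorem eq_of_extreme_add_eq {m : ℕ} (hm : 2 ≤ m) {a b a' b' c c' : Fin (m + 1)}
    (h : (a = 0 ∧ b = Fin.last m) ∨ (a = Fin.last m ∧ b = 0))
    (h' : (a' = 0 ∧ b' = Fin.last m) ∨ (a' = Fin.last m ∧ b' = 0))
    (ha : a + c = a' + c') (hb : b + c = b' + c') : c = c' := by
  have hsub : b - a = b' - a' := by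
    rw [← add_sub_add_right_eq_sub b a c, ha, hb, add_sub_add_right_eq_sub]
  have hne := last_ne_neg_last hm
  rcases h with ⟨rfl, rfl⟩ | ⟨rfl, rfl⟩ <;> rcases h' with ⟨rfl, rfl⟩ | ⟨rfl, rfl⟩
  · exact add_left_cancel ha
  · simp only [sub_zero, zero_sub] at hsub
    exact absurd hsub.symm hne
  · simp only [sub_zero, zero_sub] at hsub
    exact absurd hsub hne
  · exact add_left_cancel hb

theorem card_mul_card_Pi' {m r : ℕ} (hm : 2 ≤ m) (hr : 1 ≤ r) :
    (m + 1) * (Pi' (m + 1) r).card = (LamU (m + 1) r).card := by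
  have hcard : (m + 1) * (Pi' (m + 1) r).card =
      ((univ : Finset (Fin (m + 1))) ×ˢ Pi' (m + 1) r).card := by simp
  rw [hcard]
  refine card_bij (fun p _ => shift p.1 p.2) ?_ ?_ ?_
  · rintro ⟨c, x⟩ h
    obtain ⟨k, hk, hx, -⟩ := mem_Pi'.1 (mem_product.1 h).2
    exact mem_LamU.2 ⟨k, hk, shift_mem_Lam.2 hx⟩
  · rintro ⟨c, x⟩ h ⟨c', x'⟩ h' (heq : shift c x = shift c' x')
    obtain ⟨k, hk, hx, he⟩ := mem_Pi'.1 (mem_product.1 h).2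
    obtain ⟨k', hk', hx', he'⟩ := mem_Pi'.1 (mem_product.1 h').2
    have hs : shift c x ∈ Lam (m + 1) r k := shift_mem_Lam.2 hx
    have hs' : shift c x ∈ Lam (m + 1) r k' := heq ▸ shift_mem_Lam.2 hx'
    obtain rfl := eq_of_mem_Lam (by omega) hr hk.1 hk'.1 hs hs'
    obtain rfl : c = c' := eq_of_extreme_add_eq hm he he' (congrArg (get · k) heq)
      (congrArg (get · (k + 1)) heq)
    exact Prod.ext rfl (funext fun i => add_right_cancel (congrFun heq i))
  · intro x hx
    obtain ⟨k, hk, hx⟩ := mem_LamU.1 hx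
    have hlast : Fin.last m = -1 := eq_neg_of_add_eq_zero_left (Fin.last_add_one m)
    have hback (c : Fin (m + 1)) : shift c (shift (-c) x) = x := by
      funext i
      simp [shift]
    rcases (adj_univ_iff (by omega)).1 (mem_Lam.1 hx).2.1 with h | h
    · refine ⟨(get x (k + 1), shift (-get x (k + 1)) x),
        mem_product.2 ⟨mem_univ _, mem_Pi'.2 ⟨k, hk, shift_mem_Lam.2 hx, Or.inr ?_⟩⟩, hback _⟩
      simp [get_shift, h, hlast]
    · refine ⟨(get x k, shift (-get x k) x),
        mem_product.2 ⟨mem_univ _, mem_Pi'.2 ⟨k, hk, shift_mem_Lam.2 hx, Or.inl ?_⟩⟩, hback _⟩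
      simp [get_shift, h, hlast]

/-- if `r ∈ {3,…,n-1}`, then `n · |Π_n(r)| = |Λ_n(r)|`,
i.e. `|Π_n(r)| / |Λ_n(r)| = 1/n`. -/
theorem statement10 {n : ℕ} (hn : 3 < n) (r : ℕ) (hr1 : 3 ≤ r) (hr2 : r ≤ n - 1) :
    n * (Pi' n r).card = (LamU n r).card := by
  obtain ⟨m, rfl⟩ : ∃ m, n = m + 1 := ⟨n - 1, by omega⟩
  exact card_mul_card_Pi' (by omega) (by omega)

end Secretary
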